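/- Let a and b be square-free positive integers with gcd(a,b) ≤ 2. Then every element of the additive group LQ²_{a,b} generated by squares in the quaternion ring LQ_{a,b} can be written as a sum of three squares of elements of LQ_{a,b}. -/

import Mathlib

open Quaternion

def SqRep (a b c0 c1 c2 c3 : ℤ) : Prop :=
  ∃ x0 x1 x2 x3 y0 y1 y2 y3 w0 w1 w2 w3 : ℤ,
    c0 = (x0^2 - a*x1^2 - b*x2^2 - a*b*x3^2) + (y0^2 - a*y1^2 - b*y2^2 - a*b*y3^2)
       + (w0^2 - a*w1^2 - b*w2^2 - a*b*w3^2) ∧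
    c1 = x0*x1 + y0*y1 + w0*w1 ∧ c2 = x0*x2 + y0*y2 + w0*w2 ∧ c3 = x0*x3 + y0*y3 + w0*w3

lemma SqRep.swap {a b c0 c1 c2 c3 : ℤ} (h : SqRep b a c0 c2 c1 c3) : SqRep a b c0 c1 c2 c3 := by
  obtain ⟨x0,x1,x2,x3,y0,y1,y2,y3,w0,w1,w2,w3,h0,h1,h2,h3⟩ := h
  exact ⟨x0,x2,x1,x3,y0,y2,y1,y3,w0,w2,w1,w3, by rw [h0]; ring, h2, h1, h3⟩

lemma final_of_rep (a b : ℤ) (H : ∀ c0 c1 c2 c3, SqRep a b c0 c1 c2 c3) :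
    ∀ z ∈ AddSubgroup.closure {x : ℍ[ℤ, -a, -b] | ∃ y : ℍ[ℤ, -a, -b], x = y ^ 2},
      ∃ x y w : ℍ[ℤ, -a, -b], z = x ^ 2 + y ^ 2 + w ^ 2 := by
  intro z hz
  have hev : 2 ∣ z.imI ∧ 2 ∣ z.imJ ∧ 2 ∣ z.imK := by
    induction hz using AddSubgroup.closure_induction with
    | mem x hx =>
      obtain ⟨y, rfl⟩ := hx
      refine ⟨⟨y.re * y.imI, ?_⟩, ⟨y.re * y.imJ, ?_⟩, ⟨y.re * y.imK, ?_⟩⟩ <;>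
      · simp [pow_two]; ring
    | zero => simp
    | add x y _ _ hx hy =>
      simp only [QuaternionAlgebra.imI_add, QuaternionAlgebra.imJ_add, QuaternionAlgebra.imK_add]
      exact ⟨dvd_add hx.1 hy.1, dvd_add hx.2.1 hy.2.1, dvd_add hx.2.2 hy.2.2⟩
    | neg x _ hx => simpa using hx
  obtain ⟨⟨c1, h1⟩, ⟨c2, h2⟩, ⟨c3, h3⟩⟩ := hev
  obtain ⟨x0,x1,x2,x3,y0,y1,y2,y3,w0,w1,w2,w3,e0,e1,e2,e3⟩ := H z.re c1 c2 c3
  refine ⟨⟨x0,x1,x2,x3⟩, ⟨y0,y1,y2,y3⟩, ⟨w0,w1,w2,w3⟩, ?_⟩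
  ext
  · rw [e0]; simp [pow_two]; ring
  · rw [h1, e1]; simp [pow_two]; ring
  · rw [h2, e2]; simp [pow_two]; ring
  · rw [h3, e3]; simp [pow_two]; ring

lemma glue0 {a b l d2 d3 s2 s3 e1 e2 e3 t A u1 u2 u3 c0 c1 c2 c3 : ℤ}
    (hl : l = d2^2 + d3^2) (hs : d2*s2 + d3*s3 = 1)
    (hQ : a*e1^2 + b*e2^2 + a*b*e3^2 = l*t^2)
    (hd : t*(l*A + (d2*s3 - d3*s2)) - (a*e1*u1 + b*e2*u2 + a*b*e3*u3) = 1)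
    (hp : 2 ∣ c0 - (l*A^2 + 2*A*(d2*s3 - d3*s2) + (s2^2+s3^2) - (a*u1^2 + b*u2^2 + a*b*u3^2)
        - l*(a*c1^2 + b*c2^2 + a*b*c3^2))) : SqRep a b c0 c1 c2 c3 := by
  obtain ⟨k, hk⟩ := hp
  refine ⟨0, u1 + k*e1, u2 + k*e2, u3 + k*e3,
    (A + k*t)*d2 + s3, d3*c1, d3*c2, d3*c3,
    (A + k*t)*d3 - s2, -d2*c1, -d2*c2, -d2*c3, ?_, ?_, ?_, ?_⟩
  · subst hl
    linear_combination hk + k^2*hQ - 2*k*hd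
  · linear_combination -c1*hs
  · linear_combination -c2*hs
  · linear_combination -c3*hs

lemma glue1 {a b l d2 d3 s2 s3 e1 e2 e3 t A u1 u2 u3 c0 c1 c2 c3 : ℤ}
    (hl : l = d2^2 + d3^2) (hs : d2*s2 + d3*s3 = 1)
    (hQ : a*e1^2 + b*e2^2 + a*b*e3^2 = l*t^2)
    (hd : t*(l*A + (d2*s3 - d3*s2)) - (a*e1*u1 + b*e2*u2 + a*b*e3*u3) = 1)
    (ha : 2 ∣ a) (hb : 2 ∣ b) (hl2 : 2 ∣ l) (ht : ¬ 2 ∣ t) (hh : ¬ 2 ∣ d2*s3 - d3*s2)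
    (hS : ¬ 2 ∣ s2^2+s3^2)
    (hp : 2 ∣ c0) : SqRep a b c0 c1 c2 c3 := by
  obtain ⟨f1, hf1⟩ : ∃ f, f = c1 - t*u1 + A*e1 := ⟨_, rfl⟩
  obtain ⟨f2, hf2⟩ : ∃ f, f = c2 - t*u2 + A*e2 := ⟨_, rfl⟩
  obtain ⟨f3, hf3⟩ : ∃ f, f = c3 - t*u3 + A*e3 := ⟨_, rfl⟩
  have hp : 2 ∣ c0 - (l*A^2 + 2*A*(d2*s3 - d3*s2) + (s2^2+s3^2) - (d2*s3 - d3*s2)^2*t^2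
        - (a*u1^2 + b*u2^2 + a*b*u3^2)
        - l*(a*f1^2 + b*f2^2 + a*b*f3^2)
        - 2*(d2*s3 - d3*s2)*(a*e1*f1+b*e2*f2+a*b*e3*f3)) := by
    obtain ⟨a', rfl⟩ := ha
    obtain ⟨b', rfl⟩ := hb
    obtain ⟨l', hl'⟩ := hl2
    obtain ⟨c, rfl⟩ := hp
    have o1 : Odd t := by rw [← Int.not_even_iff_odd, even_iff_two_dvd]; exact ht
    have o2 : Odd (d2*s3 - d3*s2) := by rw [← Int.not_even_iff_odd, even_iff_two_dvd]; exact hh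
    have o3 : Odd (s2^2+s3^2) := by rw [← Int.not_even_iff_odd, even_iff_two_dvd]; exact hS
    obtain ⟨x, hx⟩ := (o3.sub_odd ((o2.pow (n := 2)).mul (o1.pow (n := 2)))).two_dvd
    refine ⟨c - (l'*A^2 + A*(d2*s3 - d3*s2) + x - (a'*u1^2 + b'*u2^2 + 2*a'*b'*u3^2)
        - l*(a'*f1^2 + b'*f2^2 + 2*a'*b'*f3^2)
        - (d2*s3 - d3*s2)*(2*a'*e1*f1+2*b'*e2*f2+4*a'*b'*e3*f3)), ?_⟩
    linear_combination -hx - A^2*hl'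
  obtain ⟨k, hk⟩ := hp
  refine ⟨t, u1 + k*e1, u2 + k*e2, u3 + k*e3,
    (A + k*t)*d2 + s3, -s2*e1+d3*f1, -s2*e2+d3*f2, -s2*e3+d3*f3,
    (A + k*t)*d3 - s2, -s3*e1-d2*f1, -s3*e2-d2*f2, -s3*e3-d2*f3, ?_, ?_, ?_, ?_⟩
  · have hN : l*(s2^2+s3^2) = 1 + (d2*s3 - d3*s2)^2 := by
      subst hl
      linear_combination (d2*s2+d3*s3+1)*hs
    have hN' := hN
    subst hl
    linear_combination hk + k^2*hQ - 2*k*hd + (s2^2+s3^2)*hQ + t^2*hN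
  · linear_combination -f1*hs + (A+k*t)*e1*hs - hf1
  · linear_combination -f2*hs + (A+k*t)*e2*hs - hf2
  · linear_combination -f3*hs + (A+k*t)*e3*hs - hf3

set_option maxHeartbeats 1000000 in
lemma legendre_pigeon (A B N : ℕ) (hA : 0 < A) (hB : 0 < B) (hN : N.Prime) (hN4 : N % 4 = 1)
    (hAB : Nat.Coprime A B) (hNA : ¬ N ∣ A) (hNB : ¬ N ∣ B)
    (h1 : (N : ℤ) ≡ B [ZMOD A]) (h2 : (N : ℤ) ≡ A [ZMOD B])
    (hsq : ∃ r : ℤ, (N : ℤ) ∣ A * r^2 + B) :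
    ∃ y z t : ℤ, t ≠ 0 ∧ A * y^2 + B * z^2 = N * t^2 := by
  obtain ⟨r, hr⟩ := hsq
  have := Fact.mk hN
  have hNpos := hN.pos
  have : NeZero A := ⟨hA.ne'⟩
  have : NeZero B := ⟨hB.ne'⟩
  have : NeZero N := ⟨hNpos.ne'⟩
  classical
  let S : Finset (ℕ × ℕ × ℕ) := Finset.range (Nat.sqrt (B*N) + 1) ×ˢ
    (Finset.range (Nat.sqrt (A*N) + 1) ×ˢ Finset.range (Nat.sqrt (A*B) + 1))
  let g : ℕ × ℕ × ℕ → ZMod A × ZMod B × ZMod N := fun p =>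
    ((((p.2.1 : ℤ) - p.2.2 : ℤ) : ZMod A), (((p.1 : ℤ) - p.2.2 : ℤ) : ZMod B),
      (((p.1 : ℤ) - r * p.2.1 : ℤ) : ZMod N))
  have hcard : (Finset.univ : Finset (ZMod A × ZMod B × ZMod N)).card < S.card := by
    simp only [Finset.card_univ, Fintype.card_prod, ZMod.card, S, Finset.card_product,
      Finset.card_range]
    have e1 := Nat.lt_succ_sqrt (B*N)
    have e2 := Nat.lt_succ_sqrt (A*N)
    have e3 := Nat.lt_succ_sqrt (A*B)
    simp only [Nat.succ_eq_add_one] at e1 e2 e3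
    set u := Nat.sqrt (B*N) + 1
    set v := Nat.sqrt (A*N) + 1
    set w := Nat.sqrt (A*B) + 1
    have : (A * (B*N))^2 < (u * (v*w))^2 := by
      calc (A * (B*N))^2 = (B*N) * ((A*N) * (A*B)) := by ring
        _ < (u*u) * ((v*v) * (w*w)) := by
          apply Nat.mul_lt_mul'' e1 (Nat.mul_lt_mul'' e2 e3)
        _ = _ := by ring
    exact lt_of_pow_lt_pow_left₀ 2 (Nat.zero_le _) this
  obtain ⟨p, hp, q, hq, hne, heq⟩ := Finset.exists_ne_map_eq_of_card_lt_of_maps_to hcard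
    (f := g) (fun _ _ => Finset.mem_univ _)
  obtain ⟨p1, p2, p3⟩ := p
  obtain ⟨q1, q2, q3⟩ := q
  simp only [S, Finset.mem_product, Finset.mem_range, Nat.lt_succ_iff] at hp hq
  simp only [g, Prod.mk.injEq, ZMod.intCast_eq_intCast_iff] at heq
  obtain ⟨c1, c2, c3⟩ := heq
  have bound : ∀ (K p q : ℕ), p ≤ Nat.sqrt K → q ≤ Nat.sqrt K → ((p:ℤ) - q)^2 ≤ K := by
    intro K p q hp hq
    have h := Nat.sqrt_le' K
    have h' : ((Nat.sqrt K : ℤ))^2 ≤ K := by exact_mod_cast h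
    have hp' : (p:ℤ) ≤ Nat.sqrt K := by exact_mod_cast hp
    have hq' : (q:ℤ) ≤ Nat.sqrt K := by exact_mod_cast hq
    have hp0 : (0:ℤ) ≤ p := by positivity
    have hq0 : (0:ℤ) ≤ q := by positivity
    nlinarith [abs_le.mpr (⟨by linarith, by linarith⟩ : -(Nat.sqrt K : ℤ) ≤ (p:ℤ) - q ∧ (p:ℤ) - q ≤ Nat.sqrt K), sq_abs ((p:ℤ)-q), abs_nonneg ((p:ℤ)-q)]
  have bdy := bound _ _ _ hp.1 hq.1
  have bz := bound _ _ _ hp.2.1 hq.2.1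
  have bt := bound _ _ _ hp.2.2 hq.2.2
  push_cast at bdy bz bt
  obtain ⟨y, hy⟩ : ∃ y : ℤ, y = (p1:ℤ) - q1 := ⟨_, rfl⟩
  obtain ⟨z, hz⟩ : ∃ y : ℤ, y = (p2:ℤ) - q2 := ⟨_, rfl⟩
  obtain ⟨t, ht⟩ : ∃ y : ℤ, y = (p3:ℤ) - q3 := ⟨_, rfl⟩
  rw [← hy] at bdy
  rw [← hz] at bz
  rw [← ht] at bt
  have hnz : ¬ (y = 0 ∧ z = 0 ∧ t = 0) := by
    rintro ⟨a1, a2, a3⟩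
    apply hne
    simp only [Prod.mk.injEq]
    omega
  have d1 : (A:ℤ) ∣ z - t := by
    have := c1.symm.dvd
    rw [hz, ht]; convert this using 1; ring
  have d2 : (B:ℤ) ∣ y - t := by
    have := c2.symm.dvd
    rw [hy, ht]; convert this using 1; ring
  have d3 : (N:ℤ) ∣ y - r * z := by
    have := c3.symm.dvd
    rw [hy, hz]; convert this using 1; ring
  have h1' := h1.dvd
  have h2' := h2.dvd
  have A0 : (0:ℤ) < A := by exact_mod_cast hA
  have B0 : (0:ℤ) < B := by exact_mod_cast hB
  have N0 : (0:ℤ) < N := by exact_mod_cast hNpos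
  have f1 : (A:ℤ) ∣ A * y^2 + B * z^2 - N * t^2 := by
    have : (A * y^2 + B * z^2 - N * t^2 : ℤ) = A * y^2 + B*(z+t) * (z-t) + (B - N) * t^2 := by ring
    rw [this]
    exact dvd_add (dvd_add (Dvd.intro _ rfl) (d1.mul_left _)) (h1'.mul_right _)
  have f2 : (B:ℤ) ∣ A * y^2 + B * z^2 - N * t^2 := by
    have : (A * y^2 + B * z^2 - N * t^2 : ℤ) = B * z^2 + A*(y+t) * (y-t) + (A - N) * t^2 := by ring
    rw [this]
    exact dvd_add (dvd_add (Dvd.intro _ rfl) (d2.mul_left _)) (h2'.mul_right _)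
  have f3 : (N:ℤ) ∣ A * y^2 + B * z^2 - N * t^2 := by
    have : (A * y^2 + B * z^2 - N * t^2 : ℤ)
      = N * (-t^2) + A*(y+r*z) * (y-r*z) + (A*r^2 + B) * z^2 := by ring
    rw [this]
    exact dvd_add (dvd_add (Dvd.intro _ rfl) (d3.mul_left _)) (hr.mul_right _)
  have cAB : IsCoprime (A:ℤ) (B:ℤ) := Nat.isCoprime_iff_coprime.mpr hAB
  have cNA : IsCoprime (A:ℤ) (N:ℤ) :=
    Nat.isCoprime_iff_coprime.mpr ((hN.coprime_iff_not_dvd.mpr hNA).symm)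
  have cNB : IsCoprime (B:ℤ) (N:ℤ) :=
    Nat.isCoprime_iff_coprime.mpr ((hN.coprime_iff_not_dvd.mpr hNB).symm)
  have f : (A * B * N : ℤ) ∣ A * y^2 + B * z^2 - N * t^2 :=
    (IsCoprime.mul_left cNA cNB).mul_dvd (cAB.mul_dvd f1 f2) f3
  obtain ⟨k, hk⟩ := f
  have M0 : (0:ℤ) < A*B*N := by positivity
  have g1 : (A:ℤ) * y^2 ≤ A*B*N := by have := mul_le_mul_of_nonneg_left bdy A0.le; linarith
  have g2 : (B:ℤ) * z^2 ≤ A*B*N := by have := mul_le_mul_of_nonneg_left bz B0.le; linarith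
  have g3 : (N:ℤ) * t^2 ≤ A*B*N := by have := mul_le_mul_of_nonneg_left bt N0.le; linarith
  have g1' : 0 ≤ (A:ℤ) * y^2 := by positivity
  have g2' : 0 ≤ (B:ℤ) * z^2 := by positivity
  have g3' : 0 ≤ (N:ℤ) * t^2 := by positivity
  have k1 : k ≤ 2 := by
    by_contra hc
    have := mul_le_mul_of_nonneg_left (show (3:ℤ) ≤ k by omega) M0.le
    linarith
  have k2 : -1 ≤ k := by
    by_contra hc
    have := mul_le_mul_of_nonneg_left (show k ≤ (-2:ℤ) by omega) M0.le
    linarith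
  have tne : k = 0 → t ≠ 0 := by
    rintro rfl rfl
    apply hnz
    have e1 : (A:ℤ) * y^2 = 0 := by linarith
    have e2 : (B:ℤ) * z^2 = 0 := by linarith
    simp [hA.ne', hB.ne'] at e1 e2
    exact ⟨e1, e2, rfl⟩
  interval_cases k
  ·
    have e1 : (A:ℤ) * y^2 = 0 := by linarith
    have e2 : (B:ℤ) * z^2 = 0 := by linarith
    simp [hA.ne', hB.ne'] at e1 e2
    subst e1 e2
    have t0 : t ≠ 0 := by
      intro h; exact hnz ⟨rfl, rfl, h⟩
    have hd : (A*B:ℤ) ∣ t := by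
      apply cAB.mul_dvd
      · simpa using d1
      · simpa using d2
    obtain ⟨c, rfl⟩ := hd
    have c0 : c ≠ 0 := by rintro rfl; simp at t0
    have c1 : 1 ≤ c^2 := by
      have : 0 < c^2 := by positivity
      omega
    have AB0 : (0:ℤ) < A * B := by positivity
    have hle : (A*B:ℤ) ≤ 1 := by
      by_contra hcon
      push Not at hcon
      nlinarith [mul_pos AB0 AB0]
    have hAle : (A:ℤ) = 1 := by nlinarith
    have hBle : (B:ℤ) = 1 := by nlinarith
    obtain ⟨x, w, hxw⟩ := Nat.Prime.sq_add_sq (p := N) (by omega)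
    refine ⟨x, w, 1, one_ne_zero, ?_⟩
    rw [hAle, hBle]
    have : (x:ℤ)^2 + w^2 = N := by exact_mod_cast hxw
    linarith
  · exact ⟨y, z, t, tne rfl, by linarith⟩
  ·
    refine ⟨y*t + B*z, z*t - A*y, t^2 + A*B, by positivity, ?_⟩
    linear_combination (t^2 + A*B) * hk
  ·
    exfalso
    have e1 : (A:ℤ) * y^2 = A * B * N := by linarith
    have e2 : y^2 = B * N := by
      have : (A:ℤ) * (y^2 - B*N) = 0 := by linarith
      rcases mul_eq_zero.mp this with h | h
      · exact absurd h A0.ne'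
      · linarith
    have hNp : Prime (N:ℤ) := Nat.prime_iff_prime_int.mp hN
    have : (N:ℤ) ∣ y := hNp.dvd_of_dvd_pow (e2 ▸ Dvd.intro_left _ rfl)
    obtain ⟨c, rfl⟩ := this
    apply hNB
    have : (N:ℤ) * (N * c^2 - B) = 0 := by linarith
    rcases mul_eq_zero.mp this with h | h
    · exact absurd h N0.ne'
    · have : (N:ℤ) ∣ B := ⟨c^2, by linarith⟩
      exact_mod_cast this

lemma exists_r_of_jacobi (A B N : ℕ) (hN : N.Prime) (hN4 : N % 4 = 1) (hNA : ¬ N ∣ A)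
    (hJ : jacobiSym ((A:ℤ) * B) N = 1) : ∃ r : ℤ, (N : ℤ) ∣ A * r^2 + B := by
  have := Fact.mk hN
  have h1 := ZMod.isSquare_of_jacobiSym_eq_one hJ
  have h2 : IsSquare (-1 : ZMod N) := ZMod.exists_sq_eq_neg_one_iff.mpr (by omega)
  obtain ⟨s, hs⟩ := h1.mul h2
  have hA0 : (A : ZMod N) ≠ 0 := by
    rwa [Ne, ZMod.natCast_eq_zero_iff]
  refine ⟨((s / A : ZMod N).val : ℤ), ?_⟩
  rw [← ZMod.intCast_zmod_eq_zero_iff_dvd]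
  push_cast
  rw [ZMod.natCast_zmod_val]
  push_cast at hs
  field_simp
  linear_combination -hs

lemma exists_prime_crt (a B v e : ℕ) (ha : a % 2 = 1) (hB : B % 2 = 1)
    (hc : Nat.Coprime a B) (hv : Nat.Coprime v B) (he : e % 2 = 1) :
    ∃ N : ℕ, N.Prime ∧ N % 8 = e % 8 ∧ N ≡ B [MOD a] ∧ N ≡ v [MOD B] ∧ 2 * a + B < N := by
  have c8 : ∀ x : ℕ, x % 2 = 1 → Nat.Coprime 8 x := by
    intro x hx
    have : Nat.Coprime 2 x := (Nat.coprime_two_left).mpr (Nat.odd_iff.mpr hx)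
    exact Nat.Coprime.pow_left 3 this
  obtain ⟨x, hx1, hx2⟩ := Nat.chineseRemainder hc B v
  have c8' : Nat.Coprime 8 (a * B) := Nat.Coprime.mul_right (c8 _ ha) (c8 _ hB)
  obtain ⟨w, hw1, hw2⟩ := Nat.chineseRemainder c8' e x
  have hwa : w ≡ B [MOD a] := (hw2.of_mul_right _).trans hx1
  have hwB : w ≡ v [MOD B] := (hw2.of_mul_left _).trans hx2
  have cop : w.Coprime (8 * (a * B)) := by
    refine Nat.Coprime.mul_right ?_ (Nat.Coprime.mul_right ?_ ?_)
    · have := hw1.gcd_eq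
      rw [Nat.Coprime, this]
      exact (c8 _ he).symm
    · rw [Nat.Coprime, hwa.gcd_eq]; exact hc.symm
    · rw [Nat.Coprime, hwB.gcd_eq]; exact hv
  have hpos : 8 * (a*B) ≠ 0 := by
    have : a ≠ 0 := by omega
    have : B ≠ 0 := by omega
    positivity
  obtain ⟨N, hgt, hp, hm⟩ := Nat.forall_exists_prime_gt_and_modEq (2*a+B) hpos cop
  refine ⟨N, hp, ?_, ?_, ?_, hgt⟩
  · exact (hm.of_mul_right _).trans hw1
  · exact ((hm.of_mul_left _).of_mul_right _).trans hwa
  · exact ((hm.of_mul_left _).of_mul_left _).trans hwB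

lemma jac_congr {x y : ℕ} {n : ℕ} (h : x ≡ y [MOD n]) : jacobiSym (x:ℤ) n = jacobiSym (y:ℤ) n := by
  apply jacobiSym.mod_left'
  exact_mod_cast h

lemma exists_N_odd (A B : ℕ) (hA : A % 2 = 1) (hB : B % 2 = 1) (hc : Nat.Coprime A B)
    (h4 : A % 4 = 1 ∨ B % 4 = 1) :
    ∃ N : ℕ, N.Prime ∧ N % 4 = 1 ∧ ¬ N ∣ A ∧ ¬ N ∣ B ∧ (N:ℤ) ≡ B [ZMOD A] ∧ (N:ℤ) ≡ A [ZMOD B] ∧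
      ∃ r : ℤ, (N : ℤ) ∣ A * r^2 + B := by
  obtain ⟨N, hp, h8, hNA, hNB, hgt⟩ := exists_prime_crt A B A 1 hA hB hc hc rfl
  have hN4 : N % 4 = 1 := by omega
  have n1 : ¬ N ∣ A := fun h => by have := Nat.le_of_dvd (by omega) h; omega
  have n2 : ¬ N ∣ B := fun h => by have := Nat.le_of_dvd (by omega) h; omega
  refine ⟨N, hp, hN4, n1, n2, by exact_mod_cast hNA, by exact_mod_cast hNB,
    exists_r_of_jacobi A B N hp hN4 n1 ?_⟩
  have oA := Nat.odd_iff.mpr hA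
  have oB := Nat.odd_iff.mpr hB
  rw [jacobiSym.mul_left, ← jacobiSym.quadratic_reciprocity_one_mod_four hN4 oA,
    ← jacobiSym.quadratic_reciprocity_one_mod_four hN4 oB, jac_congr hNA, jac_congr hNB]
  have : jacobiSym (B:ℤ) A = jacobiSym (A:ℤ) B := by
    rcases h4 with h | h
    · exact (jacobiSym.quadratic_reciprocity_one_mod_four h oB).symm
    · exact jacobiSym.quadratic_reciprocity_one_mod_four h oA
  rw [this, ← pow_two]
  exact jacobiSym.sq_one (by simpa using hc)

lemma exists_N_even (a B : ℕ) (hA : a % 2 = 1) (hB : B % 2 = 1) (hc : Nat.Coprime a B) :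
    ∃ N : ℕ, N.Prime ∧ N % 4 = 1 ∧ ¬ N ∣ 2*a ∧ ¬ N ∣ B ∧
      (N:ℤ) ≡ B [ZMOD ((2*a : ℕ) : ℤ)] ∧ (N:ℤ) ≡ ((2*a : ℕ) : ℤ) [ZMOD B] ∧
      ∃ r : ℤ, (N : ℤ) ∣ ((2*a : ℕ) : ℤ) * r^2 + B := by
  have hv : Nat.Coprime (2*a) B :=
    Nat.Coprime.mul_left (Nat.coprime_two_left.mpr (Nat.odd_iff.mpr hB)) hc
  have oA := Nat.odd_iff.mpr hA
  have oB := Nat.odd_iff.mpr hB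
  obtain ⟨e, he, hJ⟩ : ∃ e : ℕ, (e = 1 ∨ e = 5) ∧
      (if e = 1 then (1:ℤ) else -1) * jacobiSym (B:ℤ) a * jacobiSym ((2*a : ℕ):ℤ) B = 1 := by
    have g1 := jacobiSym.eq_one_or_neg_one (a := (B:ℤ)) (b := a) (by simpa using hc.symm)
    have g2 := jacobiSym.eq_one_or_neg_one (a := ((2*a : ℕ):ℤ)) (b := B) (by
      rw [Int.gcd_natCast_natCast]; exact hv)
    rcases g1 with g1 | g1 <;> rcases g2 with g2 | g2 <;> rw [g1, g2]
    · exact ⟨1, by simp⟩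
    · exact ⟨5, by simp⟩
    · exact ⟨5, by simp⟩
    · exact ⟨1, by simp⟩
  obtain ⟨N, hp, h8, hNA, hNB, hgt⟩ := exists_prime_crt a B (2*a) e hA hB hc hv (by omega)
  have hN4 : N % 4 = 1 := by omega
  have n1 : ¬ N ∣ 2*a := fun h => by have := Nat.le_of_dvd (by omega) h; omega
  have n2 : ¬ N ∣ B := fun h => by have := Nat.le_of_dvd (by omega) h; omega
  have hNA2 : N ≡ B [MOD 2*a] := by
    rw [← Nat.modEq_and_modEq_iff_modEq_mul (Nat.coprime_two_left.mpr oA)]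
    exact ⟨by unfold Nat.ModEq; omega, hNA⟩
  refine ⟨N, hp, hN4, n1, n2, by exact_mod_cast hNA2, by exact_mod_cast hNB,
    exists_r_of_jacobi (2*a) B N hp hN4 n1 ?_⟩
  have oN : Odd N := Nat.odd_iff.mpr (by omega)
  rw [jacobiSym.mul_left]
  rw [← jacobiSym.quadratic_reciprocity_one_mod_four hN4 oB, jac_congr hNB]
  rw [show (((2*a:ℕ):ℤ)) = 2 * (a:ℤ) by push_cast; ring, jacobiSym.mul_left,
    ← jacobiSym.quadratic_reciprocity_one_mod_four hN4 oA, jac_congr hNA, jacobiSym.at_two oN,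
    ZMod.χ₈_nat_eq_if_mod_eight]
  have hJ2 : (((2*a:ℕ):ℤ)) = 2 * (a:ℤ) := by push_cast; ring
  rw [hJ2] at hJ
  rcases he with rfl | rfl
  · rw [if_neg (by omega), if_pos (by omega)]
    rw [if_pos rfl] at hJ
    exact hJ
  · rw [if_neg (by omega), if_neg (by omega)]
    rw [if_neg (by norm_num)] at hJ
    exact hJ

lemma prim_sol (A B N : ℤ) : ∀ n : ℕ, ∀ y z t : ℤ, t.natAbs = n → t ≠ 0 →
    A*y^2 + B*z^2 = N*t^2 →
    ∃ y' z' t' : ℤ, A*y'^2 + B*z'^2 = N*t'^2 ∧ t' ∣ t ∧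
      ∀ p : ℤ, Prime p → p ∣ y' → p ∣ z' → p ∣ t' → False := by
  intro n
  induction n using Nat.strong_induction_on with
  | _ n ih =>
    intro y z t hn ht h
    by_cases hp : ∀ p : ℤ, Prime p → p ∣ y → p ∣ z → p ∣ t → False
    · exact ⟨y, z, t, h, dvd_rfl, hp⟩
    · simp only [not_forall] at hp
      obtain ⟨p, pp, ⟨y1, rfl⟩, ⟨z1, rfl⟩, ⟨t1, rfl⟩, -⟩ := hp
      have ht1 : t1 ≠ 0 := by rintro rfl; simp at ht
      have hp2 := (Int.prime_iff_natAbs_prime.mp pp).two_le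
      have ht2 : 0 < t1.natAbs := Int.natAbs_pos.mpr ht1
      have hlt : t1.natAbs < n := by
        rw [← hn, Int.natAbs_mul]; nlinarith
      have h1 : A*y1^2 + B*z1^2 = N*t1^2 := by
        have : p^2 ≠ 0 := pow_ne_zero _ pp.ne_zero
        apply mul_left_cancel₀ this
        linear_combination h
      obtain ⟨y', z', t', h', hd, hq⟩ := ih _ hlt y1 z1 t1 rfl ht1 h1
      exact ⟨y', z', t', h', hd.mul_left _, hq⟩

lemma sq_mod4 (x : ℤ) : (x % 2 = 0 ∧ x^2 % 4 = 0) ∨ (x % 2 = 1 ∧ x^2 % 4 = 1) := by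
  rcases Int.emod_two_eq_zero_or_one x with h | h
  · left
    obtain ⟨k, rfl⟩ : ∃ k, x = 2*k := ⟨x/2, by omega⟩
    exact ⟨h, by ring_nf; omega⟩
  · right
    obtain ⟨k, rfl⟩ : ∃ k, x = 2*k+1 := ⟨x/2, by omega⟩
    exact ⟨h, by ring_nf; omega⟩

lemma mul_mod4 (x y c d : ℤ) (hx : x % 4 = c) (hy : y % 4 = d) : (x*y) % 4 = (c*d) % 4 := by
  rw [Int.mul_emod, hx, hy]

lemma odd_sol (A B N y z t : ℤ) (hN : N % 4 = 1) (ht : t ≠ 0)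
    (hB : B % 2 = 1) (hA : (A % 4 = 2) ∨ (A % 2 = 1 ∧ (A % 4 = 1 ∨ B % 4 = 1)))
    (h : A*y^2 + B*z^2 = N*t^2) :
    ∃ y' z' t' : ℤ, A*y'^2 + B*z'^2 = N*t'^2 ∧ t' % 2 = 1 ∧
      ∀ p : ℤ, Prime p → p ∣ y' → p ∣ z' → p ∣ t' → False := by
  obtain ⟨y, z, t, h, -, hp⟩ := prim_sol A B N _ y z t rfl ht h
  rcases Int.emod_two_eq_zero_or_one t with ht2 | ht2
  swap
  · exact ⟨y, z, t, h, ht2, hp⟩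
  have hp2 : ¬ (y % 2 = 0 ∧ z % 2 = 0) := fun ⟨h1, h2⟩ =>
    hp 2 Int.prime_two (Int.dvd_of_emod_eq_zero h1) (Int.dvd_of_emod_eq_zero h2)
      (Int.dvd_of_emod_eq_zero ht2)
  suffices ∃ y' z' t' : ℤ, A*y'^2 + B*z'^2 = N*t'^2 ∧ t' % 2 = 1 by
    obtain ⟨y', z', t', h', ho⟩ := this
    obtain ⟨y'', z'', t'', h'', hd, hq⟩ := prim_sol A B N _ y' z' t' rfl (by rintro rfl; simp at ho) h'
    refine ⟨y'', z'', t'', h'', ?_, hq⟩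
    rcases Int.emod_two_eq_zero_or_one t'' with h0 | h0
    · have := (Int.dvd_of_emod_eq_zero h0).trans hd
      omega
    · exact h0
  have hr : (N*t^2) % 4 = 0 := by
    rcases sq_mod4 t with ⟨_, h2⟩ | ⟨h1, _⟩
    · rw [mul_mod4 _ _ _ _ hN h2]; norm_num
    · omega
  have key : y % 2 = 1 ∧ z % 2 = 1 ∧ (A + B) % 4 = 0 := by
    rcases sq_mod4 y with ⟨y1, y2⟩ | ⟨y1, y2⟩ <;> rcases sq_mod4 z with ⟨z1, z2⟩ | ⟨z1, z2⟩
    · exact absurd ⟨y1, z1⟩ hp2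
    · have e1 := mul_mod4 A _ _ _ rfl y2
      have e2 := mul_mod4 B _ _ _ rfl z2
      omega
    · have e1 := mul_mod4 A _ _ _ rfl y2
      have e2 := mul_mod4 B _ _ _ rfl z2
      omega
    · have e1 := mul_mod4 A _ _ _ rfl y2
      have e2 := mul_mod4 B _ _ _ rfl z2
      omega
  obtain ⟨hy, hz, hAB⟩ := key
  obtain ⟨t1, rfl⟩ : ∃ k, t = 2*k := ⟨t/2, by omega⟩
  by_cases hA3 : A % 4 = 3
  · obtain ⟨c, hc⟩ : ∃ c, A = N + 2*c := ⟨(A-N)/2, by omega⟩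
    refine ⟨c*y - (A*y - N*(2*t1)), c*z, c*(2*t1) - (A*y - N*(2*t1)), ?_, ?_⟩
    · linear_combination (c^2)*h + (A*y - N*(2*t1))^2*hc
    · have : (A*y) % 2 = 1 := by rw [Int.mul_emod, hy]; omega
      have e1 : c*(2*t1) = 2*(c*t1) := by ring
      have e2 : N*(2*t1) = 2*(N*t1) := by ring
      omega
  · obtain ⟨c, hc⟩ : ∃ c, B = N + 2*c := ⟨(B-N)/2, by omega⟩
    refine ⟨c*y, c*z - (B*z - N*(2*t1)), c*(2*t1) - (B*z - N*(2*t1)), ?_, ?_⟩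
    · linear_combination (c^2)*h + (B*z - N*(2*t1))^2*hc
    · have : (B*z) % 2 = 1 := by rw [Int.mul_emod, hz]; omega
      have e1 : c*(2*t1) = 2*(c*t1) := by ring
      have e2 : N*(2*t1) = 2*(N*t1) := by ring
      omega

lemma bez3 (x y z : ℤ) (h : ∀ p : ℤ, Prime p → p ∣ x → p ∣ y → p ∣ z → False) :
    ∃ X Y Z : ℤ, X*x + Y*y + Z*z = 1 := by
  have hc : IsCoprime x (gcd y z) := by
    by_cases h0 : x = 0 ∧ gcd y z = 0
    · exfalso
      have := (gcd_eq_zero_iff y z).mp h0.2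
      exact h 2 Int.prime_two (by simp [h0.1]) (by simp [this.1]) (by simp [this.2])
    · exact isCoprime_of_prime_dvd h0 fun p pp h1 h2 =>
        h p pp h1 (h2.trans (gcd_dvd_left _ _)) (h2.trans (gcd_dvd_right _ _))
  obtain ⟨u, v, huv⟩ := hc
  have e : gcd y z = (Int.gcd y z : ℤ) := (Int.coe_gcd y z).symm
  rw [e, Int.gcd_eq_gcd_ab] at huv
  exact ⟨u, v * Int.gcdA y z, v * Int.gcdB y z, by linear_combination huv⟩

lemma sqf_dvd {p A w : ℤ} (hp : Prime p) (hA : Squarefree A) (h : p^2 ∣ A*w) : p ∣ w := by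
  by_contra hw
  have hc : IsCoprime (p^2) w := ((Prime.coprime_iff_not_dvd hp).mpr hw).pow_left
  have h2 : p*p ∣ A := by rw [← sq]; exact hc.dvd_of_dvd_mul_right h
  exact hp.not_isUnit (hA p h2)

lemma bez_sol (A b m N y z t : ℤ) (hA : Squarefree A) (hb : Squarefree b)
    (hAb : IsCoprime A (b*m)) (hbm : IsCoprime b m) (hN : Prime N) (hNA : ¬ N ∣ A)
    (hNB : ¬ N ∣ b*m) (h : A*y^2 + b*m*z^2 = N*t^2)
    (hp : ∀ p : ℤ, Prime p → p ∣ y → p ∣ z → p ∣ t → False) :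
    ∃ X Y Z : ℤ, X*(t*N) + Y*(A*y) + Z*(b*z) = 1 := by
  apply bez3
  intro p pp h1 h2 h3
  have key : p ∣ t := by
    rcases pp.dvd_or_dvd h1 with h1 | h1
    · exact h1
    · have hass : Associated p N := pp.associated_of_dvd hN h1
      have hpA : ¬ p ∣ A := fun hh => hNA (hass.symm.dvd.trans hh)
      have hpb : ¬ p ∣ b := fun hh => hNB ((hass.symm.dvd.trans hh).mul_right _)
      have hy := (pp.dvd_or_dvd h2).resolve_left hpA
      have hz := (pp.dvd_or_dvd h3).resolve_left hpb
      obtain ⟨N1, hN1⟩ := hass.symm.dvd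
      obtain ⟨y1, rfl⟩ := hy
      obtain ⟨z1, rfl⟩ := hz
      have hnn : N*N ∣ N*t^2 := by
        rw [← h]
        refine ⟨A*N1^2*y1^2 + b*m*N1^2*z1^2, ?_⟩
        rw [hN1]; ring
      have : N ∣ t^2 := (mul_dvd_mul_iff_left hN.ne_zero).mp hnn
      exact h1.trans (hN.dvd_of_dvd_pow this)
  obtain ⟨t1, rfl⟩ := key
  have fin_y : p ∣ z → p ∣ y := fun ⟨z1, hz1⟩ => by
    refine pp.dvd_of_dvd_pow (sqf_dvd pp hA (w := y^2) ⟨N*t1^2 - b*m*z1^2, ?_⟩)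
    rw [hz1] at h
    linear_combination h
  by_cases hpA : p ∣ A
  · have hpb : ¬ p ∣ b := fun hh =>
      pp.not_isUnit (hAb.isUnit_of_dvd' hpA (hh.mul_right _))
    have hz := (pp.dvd_or_dvd h3).resolve_left hpb
    exact hp p pp (fin_y hz) hz (dvd_mul_right _ _)
  · have hy := (pp.dvd_or_dvd h2).resolve_left hpA
    refine hp p pp hy ?_ (dvd_mul_right _ _)
    rcases pp.dvd_or_dvd h3 with hpb | hz
    · obtain ⟨y1, rfl⟩ := hy
      have hmz : p ∣ m*z^2 := sqf_dvd pp hb (w := m*z^2)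
        ⟨N*t1^2 - A*y1^2, by linear_combination h⟩
      have hpm : ¬ p ∣ m := fun hh => pp.not_isUnit (hbm.isUnit_of_dvd' hpb hh)
      exact pp.dvd_of_dvd_pow ((pp.dvd_or_dvd hmz).resolve_left hpm)
    · exact hz

lemma bez2_of_sqf (L d e : ℤ) (hL : Squarefree L) (h : L = d^2 + e^2) :
    ∃ s s' : ℤ, d*s + e*s' = 1 := by
  have hc : IsCoprime d e := by
    apply isCoprime_of_prime_dvd
    · rintro ⟨rfl, rfl⟩
      apply hL.ne_zero
      rw [h]; norm_num
    · rintro p pp ⟨d', rfl⟩ ⟨e', rfl⟩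
      exact pp.not_isUnit (hL p ⟨d'^2 + e'^2, by rw [h]; ring⟩)
  obtain ⟨u, v, huv⟩ := hc
  exact ⟨u, v, by linear_combination huv⟩

lemma core (A b m : ℤ) (hA0 : 0 < A) (hb0 : 0 < b) (hm0 : 0 < m) (hA : Squarefree A)
    (hb : Squarefree b) (hAb : IsCoprime A (b*m)) (hbm : IsCoprime b m) (hodd : (b*m) % 2 = 1)
    (hpar : A % 4 = 2 ∨ (A % 2 = 1 ∧ (A % 4 = 1 ∨ (b*m) % 4 = 1))) :
    ∃ N y z t X Y Z x w s s' D E S S' : ℤ, N % 2 = 1 ∧ A*y^2 + b*m*z^2 = N*t^2 ∧ t % 2 = 1 ∧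
      X*(t*N) + Y*(A*y) + Z*(b*z) = 1 ∧ N = x^2 + w^2 ∧ x*s + w*s' = 1 ∧
      2*N = D^2 + E^2 ∧ D*S + E*S' = 1 := by
  have hB0 : 0 < b*m := mul_pos hb0 hm0
  obtain ⟨B, hB⟩ : ∃ B : ℕ, b*m = B := ⟨(b*m).toNat, by omega⟩
  obtain ⟨A', hA'⟩ : ∃ A' : ℕ, A = A' := ⟨A.toNat, by omega⟩
  have hcop : Nat.Coprime A' B := by
    rw [hB, hA'] at hAb
    exact Nat.isCoprime_iff_coprime.mp hAb
  obtain ⟨N, hN, hN4, n1, n2, c1, c2, hr⟩ : ∃ N : ℕ, N.Prime ∧ N%4=1 ∧ ¬N∣A' ∧ ¬N∣B ∧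
      (N:ℤ)≡B [ZMOD A'] ∧ (N:ℤ)≡A' [ZMOD B] ∧ ∃ r:ℤ, (N:ℤ) ∣ A'*r^2+B := by
    rcases hpar with h | ⟨h, h'⟩
    · obtain ⟨a', rfl⟩ : ∃ a', A' = 2*a' := ⟨A'/2, by omega⟩
      exact exists_N_even a' B (by omega) (by omega) (Nat.Coprime.coprime_mul_left hcop)
    · exact exists_N_odd A' B (by omega) (by omega) hcop (by omega)
  obtain ⟨y, z, t, ht, h⟩ := legendre_pigeon A' B N (by omega) (by omega) hN hN4 hcop n1 n2 c1 c2 hr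
  rw [← hA', ← hB] at h
  obtain ⟨y, z, t, h, ht, hp⟩ := odd_sol A (b*m) N y z t (by omega) ht hodd
    (by rcases hpar with h | h; exacts [Or.inl h, Or.inr h]) h
  have pN : Prime (N:ℤ) := Nat.prime_iff_prime_int.mp hN
  obtain ⟨X, Y, Z, hX⟩ := bez_sol A b m N y z t hA hb hAb hbm pN
    (by rw [hA']; exact_mod_cast n1) (by rw [hB]; exact_mod_cast n2) h hp
  have := Fact.mk hN
  obtain ⟨x, w, hxw⟩ := Nat.Prime.sq_add_sq (p := N) (by omega)
  have hxw' : (N:ℤ) = (x:ℤ)^2 + (w:ℤ)^2 := by exact_mod_cast hxw.symm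
  have htwo : (2*(N:ℤ)) = ((x:ℤ)+w)^2 + ((x:ℤ)-w)^2 := by rw [hxw']; ring
  obtain ⟨s, s', hs⟩ := bez2_of_sqf N x w pN.squarefree hxw'
  have hsq2 : Squarefree (2*(N:ℤ)) := by
    have : Squarefree (2*N) := by
      rw [Nat.squarefree_mul (Nat.coprime_two_left.mpr (Nat.odd_iff.mpr (by omega)))]
      exact ⟨Nat.prime_two.prime.squarefree, hN.prime.squarefree⟩
    exact_mod_cast Int.squarefree_natCast.mpr this
  obtain ⟨S, S', hS⟩ := bez2_of_sqf _ _ _ hsq2 htwo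
  exact ⟨N, y, z, t, X, Y, Z, x, w, s, s', _, _, S, S', by omega, h, ht, hX, hxw', hs, htwo, hS⟩

lemma caseOO (a b g k r1 r2 c0 c1 c2 c3 : ℤ) (ha : Squarefree a) (hb : Squarefree b)
    (ha0 : 0 < a) (hb0 : 0 < b) (ha2 : a % 2 = 1) (hb2 : b % 2 = 1) (hg : g*r1 + a*k*r2 = 1)
    (hm0 : 0 < g^2 + a*k^2)
    (hab : IsCoprime a (b*(g^2 + a*k^2))) (hbm : IsCoprime b (g^2 + a*k^2))
    (hm2 : (g^2 + a*k^2) % 2 = 1)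
    (h4 : a % 4 = 1 ∨ (b*(g^2 + a*k^2)) % 4 = 1) : SqRep a b c0 c1 c2 c3 := by
  have hodd : (b*(g^2 + a*k^2)) % 2 = 1 := by rw [Int.mul_emod, hb2, hm2]; rfl
  obtain ⟨N, y, z, t, X, Y, Z, x, w, s, s', -, -, -, -, hN, h, ht, hX, hxw, hs, -, -⟩ :=
    core a b (g^2 + a*k^2) ha0 hb0 hm0 ha hb hab hbm hodd (Or.inr ⟨ha2, h4⟩)
  obtain ⟨v, hv⟩ : ∃ v, v = 1 - t*(x*s' - w*s) := ⟨_, rfl⟩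
  obtain ⟨A, hA⟩ : ∃ A, A = X*v := ⟨_, rfl⟩
  obtain ⟨u1, hu1⟩ : ∃ u, u = -Y*v := ⟨_, rfl⟩
  obtain ⟨u2, hu2⟩ : ∃ u, u = -Z*v*r1 := ⟨_, rfl⟩
  obtain ⟨u3, hu3⟩ : ∃ u, u = -Z*v*r2 := ⟨_, rfl⟩
  have hQ : a*y^2 + b*(g*z)^2 + a*b*(k*z)^2 = N*t^2 := by linear_combination h
  have hd : t*(N*A + (x*s' - w*s)) - (a*y*u1 + b*(g*z)*u2 + a*b*(k*z)*u3) = 1 := by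
    rw [hA, hu1, hu2, hu3]
    linear_combination v*hX + b*z*Z*v*hg + hv
  have hd' : t*(N*A + (x*s' - w*s)) - (a*y*u1 + b*(g*z)*(u2 + a*k) + a*b*(k*z)*(u3 - g)) = 1 := by
    linear_combination hd
  by_cases hp : 2 ∣ c0 - (N*A^2 + 2*A*(x*s' - w*s) + (s^2+s'^2) - (a*u1^2 + b*u2^2 + a*b*u3^2)
        - N*(a*c1^2 + b*c2^2 + a*b*c3^2))
  · exact glue0 hxw hs hQ hd hp
  · refine glue0 hxw hs hQ hd' ?_
    have e : (a*u1^2 + b*(u2 + a*k)^2 + a*b*(u3 - g)^2) = (a*u1^2 + b*u2^2 + a*b*u3^2)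
       + (2*(b*u2*a*k - a*b*u3*g) + a*(b*(g^2 + a*k^2))) := by ring
    have o : (a*(b*(g^2 + a*k^2))) % 2 = 1 := by rw [Int.mul_emod, ha2, hodd]; rfl
    rw [e]
    omega

lemma caseOE (a b' c0 c1 c2 c3 : ℤ) (ha : Squarefree a) (hb : Squarefree b')
    (ha0 : 0 < a) (hb0 : 0 < b') (ha2 : a % 2 = 1) (hb2 : b' % 2 = 1)
    (hab : IsCoprime a b') : SqRep a (2*b') c0 c1 c2 c3 := by
  have hA : Squarefree (2*a) := by
    have hc : IsCoprime (2:ℤ) a := ⟨-(a/2), 1, by omega⟩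
    rw [squarefree_mul_iff]
    exact ⟨hc.isRelPrime, Int.prime_two.squarefree, ha⟩
  have hc2 : IsCoprime (2:ℤ) b' := ⟨-(b'/2), 1, by omega⟩
  obtain ⟨N, y, z, t, X, Y, Z, -, -, -, -, x, w, s, s', hN, h, ht, hX, -, -, hxw, hs⟩ :=
    core (2*a) b' 1 (by omega) hb0 one_pos hA hb (by rw [mul_one]; exact hc2.mul_left hab)
      isCoprime_one_right (by omega) (Or.inl (by omega))
  have hid : 2*N*(s^2+s'^2) = 1 + (x*s' - w*s)^2 := by
    linear_combination (s^2+s'^2)*hxw + (x*s+w*s'+1)*hs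
  obtain ⟨hh, hhd⟩ : ∃ q, q = x*s' - w*s := ⟨_, rfl⟩
  have ho : hh % 2 = 1 := by
    rcases sq_mod4 hh with ⟨h1, h2⟩ | ⟨h1, h2⟩
    · rw [← hhd, mul_assoc] at hid; omega
    · exact h1
  have hz : z % 2 = 1 := by
    rcases Int.emod_two_eq_zero_or_one z with h0 | h0
    · exfalso
      obtain ⟨z1, rfl⟩ : ∃ k, z = 2*k := ⟨z/2, by omega⟩
      have e1 : (N*t^2) % 2 = 1 := by simp [Int.mul_emod, pow_two, hN, ht]
      have e2 : N*t^2 = 2*(a*y^2 + 2*b'*z1^2) := by rw [← h]; ring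
      omega
    · exact h0
  have hth : (t*hh) % 2 = 1 := by rw [Int.mul_emod, ht, ho]; rfl
  obtain ⟨v, hv⟩ : ∃ v, 1 - t*hh = 2*v := ⟨(1-t*hh)/2, by omega⟩
  obtain ⟨A, hA⟩ : ∃ A, A = X*v := ⟨_, rfl⟩
  obtain ⟨u1, hu1⟩ : ∃ u, u = -2*Y*v := ⟨_, rfl⟩
  obtain ⟨u2, hu2⟩ : ∃ u, u = -Z*v := ⟨_, rfl⟩
  have hQ : a*(2*y)^2 + (2*b')*z^2 + a*(2*b')*0^2 = 2*N*t^2 := by linear_combination 2*h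
  have hd : t*(2*N*A + (x*s' - w*s)) - (a*(2*y)*u1 + (2*b')*z*u2 + a*(2*b')*0*0) = 1 := by
    rw [hA, hu1, hu2, ← hhd]
    linear_combination 2*v*hX - hv
  have hd' : t*(2*N*A + (x*s' - w*s))
      - (a*(2*y)*(u1 + b'*z) + (2*b')*z*(u2 - a*y) + a*(2*b')*0*0) = 1 := by
    linear_combination hd
  by_cases hp : 2 ∣ c0 - (2*N*A^2 + 2*A*(x*s' - w*s) + (s^2+s'^2)
        - (a*u1^2 + (2*b')*u2^2 + a*(2*b')*0^2)
        - 2*N*(a*c1^2 + (2*b')*c2^2 + a*(2*b')*c3^2))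
  · exact glue0 hxw hs hQ hd hp
  · refine glue0 hxw hs hQ hd' ?_
    have e : (a*(u1 + b'*z)^2 + (2*b')*(u2 - a*y)^2 + a*(2*b')*0^2)
      = (a*u1^2 + (2*b')*u2^2 + a*(2*b')*0^2)
       + (2*(a*u1*b'*z - 2*b'*u2*a*y + b'*a^2*y^2) + a*(b'*z)^2) := by ring
    have o : (a*(b'*z)^2) % 2 = 1 := by simp [Int.mul_emod, pow_two, ha2, hb2, hz]
    rw [e]
    omega

lemma caseEE (a b g k r1 r2 c0 c1 c2 c3 : ℤ) (ha : Squarefree a) (hb : Squarefree b)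
    (ha0 : 0 < a) (hb0 : 0 < b) (ha2 : a % 2 = 1) (hb2 : b % 2 = 1) (hg : g*r1 + 2*a*k*r2 = 1)
    (hm0 : 0 < g^2 + 2*a*k^2)
    (hab : IsCoprime a (b*(g^2 + 2*a*k^2))) (hbm : IsCoprime b (g^2 + 2*a*k^2))
    (hm2 : (g^2 + 2*a*k^2) % 2 = 1)
    (h4 : a % 4 = 1 ∨ (b*(g^2 + 2*a*k^2)) % 4 = 1) : SqRep (2*a) (2*b) c0 c1 c2 c3 := by
  have hodd : (b*(g^2 + 2*a*k^2)) % 2 = 1 := by rw [Int.mul_emod, hb2, hm2]; rfl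
  obtain ⟨N, y, z, t, X, Y, Z, -, -, -, -, x, w, s, s', hN, h, ht, hX, -, -, hxw, hs⟩ :=
    core a b (g^2 + 2*a*k^2) ha0 hb0 hm0 ha hb hab hbm hodd (Or.inr ⟨ha2, h4⟩)
  have hid : 2*N*(s^2+s'^2) = 1 + (x*s' - w*s)^2 := by
    linear_combination (s^2+s'^2)*hxw + (x*s+w*s'+1)*hs
  obtain ⟨hh, hhd⟩ : ∃ q, q = x*s' - w*s := ⟨_, rfl⟩
  have ho : hh % 2 = 1 ∧ hh^2 % 4 = 1 := by
    rcases sq_mod4 hh with ⟨h1, h2⟩ | h1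
    · rw [← hhd, mul_assoc] at hid; omega
    · exact h1
  have hS : (s^2 + s'^2) % 2 = 1 := by
    rcases Int.emod_two_eq_zero_or_one (s^2+s'^2) with h0 | h0
    · exfalso
      obtain ⟨q, hq⟩ : ∃ q, s^2+s'^2 = 2*q := ⟨(s^2+s'^2)/2, by omega⟩
      have e : 2*N*(s^2+s'^2) = 4*(N*q) := by rw [hq]; ring
      rw [e, ← hhd] at hid
      omega
    · exact h0
  have hth : (t*hh) % 2 = 1 := by rw [Int.mul_emod, ht, ho.1]; rfl
  obtain ⟨v, hv⟩ : ∃ v, 1 - t*hh = 2*v := ⟨(1-t*hh)/2, by omega⟩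
  obtain ⟨A, hA⟩ : ∃ A, A = X*v := ⟨_, rfl⟩
  obtain ⟨u1, hu1⟩ : ∃ u, u = -Y*v := ⟨_, rfl⟩
  obtain ⟨u2, hu2⟩ : ∃ u, u = -Z*v*r1 := ⟨_, rfl⟩
  obtain ⟨u3, hu3⟩ : ∃ u, u = -Z*v*r2 := ⟨_, rfl⟩
  have hQ : (2*a)*y^2 + (2*b)*(g*z)^2 + (2*a)*(2*b)*(k*z)^2 = 2*N*t^2 := by
    linear_combination 2*h
  have hd : t*(2*N*A + (x*s' - w*s)) - ((2*a)*y*u1 + (2*b)*(g*z)*u2 + (2*a)*(2*b)*(k*z)*u3) = 1 := by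
    rw [hA, hu1, hu2, hu3, ← hhd]
    linear_combination 2*v*hX + 2*b*z*Z*v*hg - hv
  by_cases hp : 2 ∣ c0
  · exact glue1 hxw hs hQ hd (dvd_mul_right _ _) (dvd_mul_right _ _)
      (by rw [mul_assoc] at *; exact dvd_mul_right _ _) (by omega) (by rw [← hhd]; omega) (by omega) hp
  · refine glue0 hxw hs hQ hd ?_
    have e : c0 - (2*N*A^2 + 2*A*(x*s' - w*s) + (s^2+s'^2)
        - ((2*a)*u1^2 + (2*b)*u2^2 + (2*a)*(2*b)*u3^2)
        - 2*N*((2*a)*c1^2 + (2*b)*c2^2 + (2*a)*(2*b)*c3^2))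
      = c0 - (s^2+s'^2) + 2*(-(N*A^2 + A*(x*s'-w*s)) + (a*u1^2+b*u2^2+2*a*b*u3^2)
        + N*((2*a)*c1^2 + (2*b)*c2^2 + (2*a)*(2*b)*c3^2)) := by ring
    rw [e]
    omega

lemma rep_OO (a b c0 c1 c2 c3 : ℤ) (ha : Squarefree a) (hb : Squarefree b)
    (ha0 : 0 < a) (hb0 : 0 < b) (ha2 : a % 2 = 1) (hb2 : b % 2 = 1)
    (hab : IsCoprime a b) : SqRep a b c0 c1 c2 c3 := by
  by_cases h4 : a % 4 = 1 ∨ b % 4 = 1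
  · exact caseOO a b 1 0 1 0 c0 c1 c2 c3 ha hb ha0 hb0 ha2 hb2 (by ring) (by norm_num)
      (by simpa using hab) (by simpa using isCoprime_one_right) (by norm_num) (by simpa using h4)
  · have h2a : IsCoprime (2:ℤ) a := ⟨-(a/2), 1, by omega⟩
    have hga : IsCoprime (2*b) a := h2a.mul_left hab.symm
    obtain ⟨r1, r2, hr⟩ := hga
    have hm : ((2*b)^2 + a*1^2) % 4 = 3 := by
      have : (2*b)^2 + a*1^2 = 4*b^2 + a := by ring
      omega
    refine caseOO a b (2*b) 1 r1 r2 c0 c1 c2 c3 ha hb ha0 hb0 ha2 hb2 (by linear_combination hr)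
      (by positivity) ?_ ?_ (by omega) (Or.inr ?_)
    · refine hab.mul_right ?_
      have : IsCoprime a ((2*b)^2) := (h2a.symm.mul_right hab).pow_right
      simpa using this.add_mul_left_right 1
    · have := hab.symm.add_mul_left_right (4*b)
      rwa [show a + b*(4*b) = (2*b)^2 + a*1^2 by ring] at this
    · rw [mul_mod4 b _ 3 3 (by omega) hm]; norm_num

lemma rep_EE (a b c0 c1 c2 c3 : ℤ) (ha : Squarefree a) (hb : Squarefree b)
    (ha0 : 0 < a) (hb0 : 0 < b) (ha2 : a % 2 = 1) (hb2 : b % 2 = 1)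
    (hab : IsCoprime a b) : SqRep (2*a) (2*b) c0 c1 c2 c3 := by
  by_cases h4 : a % 4 = 1 ∨ b % 4 = 1
  · exact caseEE a b 1 0 1 0 c0 c1 c2 c3 ha hb ha0 hb0 ha2 hb2 (by ring) (by norm_num)
      (by simpa using hab) (by simpa using isCoprime_one_right) (by norm_num) (by simpa using h4)
  · have h2b : IsCoprime (2:ℤ) b := ⟨-(b/2), 1, by omega⟩
    obtain ⟨r1, r2, hr⟩ : IsCoprime b (2*a) := h2b.symm.mul_right hab.symm
    have hm : (b^2 + 2*a*1^2) % 4 = 3 := by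
      rcases sq_mod4 b with ⟨h1, h2⟩ | ⟨h1, h2⟩ <;> omega
    refine caseEE a b b 1 r1 r2 c0 c1 c2 c3 ha hb ha0 hb0 ha2 hb2 (by linear_combination hr)
      (by positivity) ?_ ?_ (by omega) (Or.inr ?_)
    · refine hab.mul_right ?_
      have : IsCoprime a (b^2) := hab.pow_right
      have := this.add_mul_left_right 2
      rwa [show b^2 + a*2 = b^2 + 2*a*1^2 by ring] at this
    · have : IsCoprime b (2*a) := h2b.symm.mul_right hab.symm
      have := this.add_mul_left_right b
      rwa [show 2*a + b*b = b^2 + 2*a*1^2 by ring] at this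
    · rw [mul_mod4 b _ 3 3 (by omega) hm]; norm_num

lemma half_odd {a : ℤ} (h : Squarefree (2*a)) : Squarefree a ∧ a % 2 = 1 := by
  refine ⟨h.squarefree_of_dvd (dvd_mul_left _ _), ?_⟩
  rcases Int.emod_two_eq_zero_or_one a with h0 | h0
  · exfalso
    have := h 2 ⟨a/2, by omega⟩
    exact Int.prime_two.not_isUnit this
  · exact h0

lemma rep_all (a b : ℤ) (ha : Squarefree a) (hb : Squarefree b)
    (ha0 : 0 < a) (hb0 : 0 < b) (hg : Int.gcd a b ≤ 2) (c0 c1 c2 c3 : ℤ) :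
    SqRep a b c0 c1 c2 c3 := by
  have hgpos : 0 < Int.gcd a b := Int.gcd_pos_of_ne_zero_left _ ha0.ne'
  have d1 : ((Int.gcd a b : ℕ) : ℤ) ∣ a := Int.gcd_dvd_left ..
  have d2 : ((Int.gcd a b : ℕ) : ℤ) ∣ b := Int.gcd_dvd_right ..
  have hcop : ¬ (a % 2 = 0 ∧ b % 2 = 0) → IsCoprime a b := fun hn => by
    rw [Int.isCoprime_iff_gcd_eq_one]
    by_contra h1
    have h2 : Int.gcd a b = 2 := by omega
    rw [h2] at d1 d2
    push_cast at d1 d2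
    omega
  rcases Int.emod_two_eq_zero_or_one a with pa | pa <;>
    rcases Int.emod_two_eq_zero_or_one b with pb | pb
  · obtain ⟨a, rfl⟩ : ∃ k, a = 2*k := ⟨a/2, by omega⟩
    obtain ⟨b, rfl⟩ : ∃ k, b = 2*k := ⟨b/2, by omega⟩
    obtain ⟨sa, oa⟩ := half_odd ha
    obtain ⟨sb, ob⟩ := half_odd hb
    refine rep_EE a b c0 c1 c2 c3 sa sb (by omega) (by omega) oa ob ?_
    rw [Int.isCoprime_iff_gcd_eq_one]
    rw [Int.gcd_mul_left] at hg hgpos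
    norm_num at hg hgpos
    have := Int.gcd_pos_of_ne_zero_left b (a := a) (by omega)
    omega
  · have hc := hcop (by omega)
    obtain ⟨a, rfl⟩ : ∃ k, a = 2*k := ⟨a/2, by omega⟩
    obtain ⟨sa, oa⟩ := half_odd ha
    exact (caseOE b a c0 c2 c1 c3 hb sa hb0 (by omega) pb oa hc.of_mul_left_right.symm).swap
  · have hc := hcop (by omega)
    obtain ⟨b, rfl⟩ : ∃ k, b = 2*k := ⟨b/2, by omega⟩
    obtain ⟨sb, ob⟩ := half_odd hb
    exact caseOE a b c0 c1 c2 c3 ha sb ha0 (by omega) pa ob hc.of_mul_right_right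
  · exact rep_OO a b c0 c1 c2 c3 ha hb ha0 hb0 pa pb (hcop (by omega))

theorem stmt_16 (a b : ℤ) (ha : Squarefree a) (hb : Squarefree b)
    (hapos : 0 < a) (hbpos : 0 < b) (hgcd : Int.gcd a b ≤ 2) :
    ∀ z ∈ AddSubgroup.closure {x : ℍ[ℤ, -a, -b] | ∃ y : ℍ[ℤ, -a, -b], x = y ^ 2},
      ∃ x y w : ℍ[ℤ, -a, -b], z = x ^ 2 + y ^ 2 + w ^ 2 :=
  final_of_rep a b (rep_all a b ha hb hapos hbpos hgcd)
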